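/- For every a ∈ ℝ^{2n+1}, one has ā ∗ a = a ∗ ā = ‖a‖² e₁ in the Vidinli algebra, where x̄ := 2(x·e₁) e₁ − x. Consequently every nonzero a is two-sided invertible: the element b := ā / ‖a‖² satisfies a ∗ b = b ∗ a = e₁. -/

import Mathlib

noncomputable section

/-- Standard dot product on `ℝ^m`. -/
def dot {m : ℕ} (a b : Fin m → ℝ) : ℝ := ∑ i, a i * b i

/-- The distinguished unit vector `e₁` of the Vidinli algebra (index `0`). -/
def e1 (n : ℕ) : Fin (2*n+1) → ℝ := fun i => if i.val = 0 then 1 else 0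

/-- The standard symplectic form `ω` on `ℝ^{2n+1}` (vanishing on `e₁`):
`ω(a,b) = Σ_{k=1}^n (a_{2k} b_{2k+1} − a_{2k+1} b_{2k})` in the paper's 1-based indexing. -/
def omg (n : ℕ) (a b : Fin (2*n+1) → ℝ) : ℝ :=
  ∑ k : Fin n,
    (a ⟨2*k.val+1, by have := k.isLt; omega⟩ * b ⟨2*k.val+2, by have := k.isLt; omega⟩
   - a ⟨2*k.val+2, by have := k.isLt; omega⟩ * b ⟨2*k.val+1, by have := k.isLt; omega⟩)

/-- The Vidinli multiplication on `ℝ^{2n+1}`. -/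
def vprod (n : ℕ) (a b : Fin (2*n+1) → ℝ) : Fin (2*n+1) → ℝ :=
  dot a (e1 n) • b + dot b (e1 n) • a - dot a b • e1 n + omg n a b • e1 n

/-- The `e₁`-conjugate `x̄ = 2(x·e₁)e₁ − x`. -/
def vconj (n : ℕ) (x : Fin (2*n+1) → ℝ) : Fin (2*n+1) → ℝ :=
  (2 * dot x (e1 n)) • e1 n - x

lemma dot_comm {m : ℕ} (a b : Fin m → ℝ) : dot a b = dot b a := by
  simp only [dot, mul_comm]

lemma dot_smul {m : ℕ} (c : ℝ) (a b : Fin m → ℝ) : dot a (c • b) = c * dot a b := by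
  simp only [dot, Finset.mul_sum, Pi.smul_apply, smul_eq_mul, mul_left_comm]

lemma smul_dot {m : ℕ} (c : ℝ) (a b : Fin m → ℝ) : dot (c • a) b = c * dot a b := by
  rw [dot_comm, dot_smul, dot_comm]

lemma dot_sub {m : ℕ} (a b c : Fin m → ℝ) : dot a (b - c) = dot a b - dot a c := by
  simp only [dot, ← Finset.sum_sub_distrib, Pi.sub_apply, mul_sub]

lemma dot_self_ne_zero {m : ℕ} {a : Fin m → ℝ} (ha : a ≠ 0) : dot a a ≠ 0 :=
  fun h => ha (dotProduct_self_eq_zero.mp h)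

lemma dot_e1_self (n : ℕ) : dot (e1 n) (e1 n) = 1 := by
  simp [dot, e1]

lemma dot_vconj (n : ℕ) (a : Fin (2*n+1) → ℝ) :
    dot a (vconj n a) = 2 * dot a (e1 n) ^ 2 - dot a a := by
  rw [vconj, dot_sub, dot_smul]
  ring

lemma vconj_dot_e1 (n : ℕ) (a : Fin (2*n+1) → ℝ) :
    dot (vconj n a) (e1 n) = dot a (e1 n) := by
  rw [dot_comm, vconj, dot_sub, dot_smul, dot_e1_self, dot_comm (e1 n) a]
  ring

lemma omg_swap (n : ℕ) (a b : Fin (2*n+1) → ℝ) : omg n b a = -omg n a b := by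
  simp only [omg, ← Finset.sum_neg_distrib]
  exact Finset.sum_congr rfl fun _ _ => by ring

lemma omg_smul (n : ℕ) (c : ℝ) (a b : Fin (2*n+1) → ℝ) :
    omg n a (c • b) = c * omg n a b := by
  simp only [omg, Finset.mul_sum, Pi.smul_apply, smul_eq_mul]
  exact Finset.sum_congr rfl fun _ _ => by ring

lemma smul_omg (n : ℕ) (c : ℝ) (a b : Fin (2*n+1) → ℝ) :
    omg n (c • a) b = c * omg n a b := by
  rw [omg_swap, omg_smul, omg_swap n a b]
  ring

lemma omg_vconj (n : ℕ) (a : Fin (2*n+1) → ℝ) : omg n a (vconj n a) = 0 := by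
  refine Finset.sum_eq_zero fun k _ => ?_
  simp [vconj, e1]
  ring

lemma vprod_smul (n : ℕ) (c : ℝ) (a b : Fin (2*n+1) → ℝ) :
    vprod n a (c • b) = c • vprod n a b := by
  simp only [vprod, smul_dot, dot_smul, omg_smul]
  module

lemma smul_vprod (n : ℕ) (c : ℝ) (a b : Fin (2*n+1) → ℝ) :
    vprod n (c • a) b = c • vprod n a b := by
  simp only [vprod, smul_dot, smul_omg]
  module

lemma vprod_vconj (n : ℕ) (a : Fin (2*n+1) → ℝ) :
    vprod n a (vconj n a) = dot a a • e1 n := by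
  rw [vprod, vconj_dot_e1, dot_vconj, omg_vconj, vconj]
  module

lemma vconj_vprod (n : ℕ) (a : Fin (2*n+1) → ℝ) :
    vprod n (vconj n a) a = dot a a • e1 n := by
  rw [vprod, vconj_dot_e1, dot_comm (vconj n a) a, dot_vconj, omg_swap, omg_vconj, vconj]
  module

/-- `ā ∗ a = a ∗ ā = ‖a‖² e₁`; consequently every nonzero `a` is
two-sided invertible with inverse `ā/‖a‖²`. -/
theorem vidinli_inverses (n : ℕ) (hn : 1 ≤ n) :
    (∀ a : Fin (2*n+1) → ℝ,
      vprod n (vconj n a) a = dot a a • e1 n ∧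
      vprod n a (vconj n a) = dot a a • e1 n) ∧
    (∀ a : Fin (2*n+1) → ℝ, a ≠ 0 →
      vprod n a ((dot a a)⁻¹ • vconj n a) = e1 n ∧
      vprod n ((dot a a)⁻¹ • vconj n a) a = e1 n) := by
  refine ⟨fun a => ⟨vconj_vprod n a, vprod_vconj n a⟩, fun a ha => ⟨?_, ?_⟩⟩
  · rw [vprod_smul, vprod_vconj, inv_smul_smul₀ (dot_self_ne_zero ha)]
  · rw [smul_vprod, vconj_vprod, inv_smul_smul₀ (dot_self_ne_zero ha)]
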